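/- arXiv:quant-ph/0503083 — 5 statements merged into one kernel-verified Lean document; each statement's English description precedes it below -/
import Mathlib

section
/- Let (Σ, L, κ) be a state property system satisfying the axiom OrthoCom. For any indexed family (a_i) of classical properties of L, the infimum ⨅ i, a_i is again a classical property. -/
/-- A state property system `(σ, L, κ)` equipped with an orthocomplementation
satisfying the axiom **OrthoCom**. -/
structure OrthoSPS (σ : Type*) (L : Type*) [CompleteLattice L] where
  /-- the Cartan map -/
  κ : L → Set σ
  κ_bot : κ ⊥ = ∅
  κ_top : κ ⊤ = Set.univ
  κ_sInf : ∀ s : Set L, κ (sInf s) = ⋂ a ∈ s, κ a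
  le_iff : ∀ a b : L, a ≤ b ↔ κ a ⊆ κ b
  /-- the orthocomplementation -/
  perp : L → L
  perp_perp : ∀ a : L, perp (perp a) = a
  perp_anti : ∀ a b : L, a ≤ b → perp b ≤ perp a
  inf_perp : ∀ a : L, a ⊓ perp a = ⊥
  sup_perp : ∀ a : L, a ⊔ perp a = ⊤
  /-- axiom OrthoCom: any state orthogonal to every state in `κ a` lies in `κ (perp a)` -/
  orthoCom : ∀ (a : L) (q : σ),
    (∀ p ∈ κ a, ∃ b : L, q ∈ κ b ∧ p ∈ κ (perp b)) → q ∈ κ (perp a)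

namespace OrthoSPS

variable {σ : Type*} {L : Type*} [CompleteLattice L]

/-- orthogonality of two states: `p ⊥ q` -/
def PerpState (S : OrthoSPS σ L) (p q : σ) : Prop :=
  ∃ a : L, p ∈ S.κ a ∧ q ∈ S.κ (S.perp a)

/-- a property `a` is classical if every state is in `κ a` or in `κ (perp a)` -/
def IsClassical (S : OrthoSPS σ L) (a : L) : Prop :=
  ∀ p : σ, p ∈ S.κ a ∨ p ∈ S.κ (S.perp a)

/-- the classical state `ω p` of a state `p`: the infimum of all classical properties
actual in `p` -/
def classicalState (S : OrthoSPS σ L) (p : σ) : L :=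
  sInf {a : L | S.IsClassical a ∧ p ∈ S.κ a}

/-- `Ω`, the set of all classical states -/
def Omega (S : OrthoSPS σ L) : Set L :=
  Set.range S.classicalState

/-- the classical Cartan map `κ_c` -/
def κc (S : OrthoSPS σ L) (a : L) : Set L :=
  S.classicalState '' S.κ a

end OrthoSPS

/-- the infimum of any indexed family of classical properties is classical. -/
theorem iInf_isClassical {σ L : Type*} [CompleteLattice L] (S : OrthoSPS σ L)
    {ι : Type*} (a : ι → L) (h : ∀ i, S.IsClassical (a i)) :
    S.IsClassical (⨅ i, a i) := by
  intro p
  by_cases hp : ∀ i, p ∈ S.κ (a i)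
  · left
    rw [iInf, S.κ_sInf]
    simpa using hp
  · right
    obtain ⟨i, hi⟩ := not_forall.mp hp
    exact (S.le_iff _ _).mp (S.perp_anti _ _ (iInf_le a i)) ((h i p).resolve_left hi)
end

section
/- Let (Σ, L, κ) be a state property system satisfying the axiom OrthoCom. For any indexed family (a_i) of classical properties of L, the supremum ⨆ i, a_i is again a classical property. -/
/-- the supremum of any indexed family of classical properties is classical. -/
theorem iSup_isClassical {σ L : Type*} [CompleteLattice L] (S : OrthoSPS σ L)
    {ι : Type*} (a : ι → L) (h : ∀ i, S.IsClassical (a i)) :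
    S.IsClassical (⨆ i, a i) := by
  intro p
  by_cases hp : ∃ i, p ∈ S.κ (a i)
  · obtain ⟨i, hi⟩ := hp
    exact Or.inl ((S.le_iff _ _).1 (le_iSup a i) hi)
  · right
    have hinf : p ∈ S.κ (⨅ i, S.perp (a i)) := by
      rw [iInf, S.κ_sInf]
      simp only [Set.mem_iInter, Set.forall_mem_range]
      exact fun i => (h i p).resolve_left fun hi => hp ⟨i, hi⟩
    have hsup : ⨆ i, a i ≤ S.perp (⨅ i, S.perp (a i)) := iSup_le fun i => by
      simpa only [S.perp_perp] using S.perp_anti _ _ (iInf_le (fun i => S.perp (a i)) i)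
    have hle : ⨅ i, S.perp (a i) ≤ S.perp (⨆ i, a i) := by
      simpa only [S.perp_perp] using S.perp_anti _ _ hsup
    exact (S.le_iff _ _).1 hle hinf
end

section
/- Let (Σ, L, κ) be a state property system satisfying the axiom OrthoCom. For classical properties a and b one has a ≤ b if and only if κ_c(a) ⊆ κ_c(b). -/
namespace OrthoSPS

variable {σ : Type*} {L : Type*} [CompleteLattice L]

theorem mem_κ_classicalState (S : OrthoSPS σ L) (p : σ) : p ∈ S.κ (S.classicalState p) := by
  rw [classicalState, S.κ_sInf]
  exact Set.mem_iInter₂.2 fun _ h => h.2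

theorem classicalState_le (S : OrthoSPS σ L) {a : L} {p : σ} (ha : S.IsClassical a)
    (hp : p ∈ S.κ a) : S.classicalState p ≤ a :=
  sInf_le ⟨ha, hp⟩

end OrthoSPS

/-- for classical properties `a`, `b` one has `a ≤ b ↔ κ_c a ⊆ κ_c b`. -/
theorem κc_le_iff {σ L : Type*} [CompleteLattice L] (S : OrthoSPS σ L)
    (a b : L) (ha : S.IsClassical a) (hb : S.IsClassical b) :
    a ≤ b ↔ S.κc a ⊆ S.κc b := by
  refine ⟨fun h => Set.image_mono ((S.le_iff a b).1 h), fun h => (S.le_iff a b).2 fun p hp => ?_⟩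
  obtain ⟨q, hq, hqp⟩ := h (Set.mem_image_of_mem _ hp)
  have hpb : S.classicalState p ≤ b := hqp ▸ S.classicalState_le hb hq
  exact (S.le_iff _ _).1 hpb (S.mem_κ_classicalState p)
end

section
/- Let (Σ, L, κ) be a state property system satisfying the axiom OrthoCom. For every x ∈ L and every classical property a, one has x = (x ⊓ a) ⊔ (x ⊓ aᗮ). -/
namespace OrthoSPS

theorem κ_inf {σ L : Type*} [CompleteLattice L] (S : OrthoSPS σ L) (a b : L) :
    S.κ (a ⊓ b) = S.κ a ∩ S.κ b := by
  rw [← sInf_pair, S.κ_sInf, Set.biInter_pair]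

end OrthoSPS

/-- for every `x` and every classical `a`, `x = (x ⊓ a) ⊔ (x ⊓ perp a)`. -/
theorem eq_inf_sup_inf_perp {σ L : Type*} [CompleteLattice L] (S : OrthoSPS σ L)
    (x a : L) (ha : S.IsClassical a) :
    x = (x ⊓ a) ⊔ (x ⊓ S.perp a) := by
  refine le_antisymm ((S.le_iff _ _).2 fun p hp => ?_) (sup_le inf_le_left inf_le_left)
  rcases ha p with h | h
  · exact (S.le_iff _ _).1 le_sup_left (S.κ_inf x a ▸ ⟨hp, h⟩)
  · exact (S.le_iff _ _).1 le_sup_right (S.κ_inf x (S.perp a) ▸ ⟨hp, h⟩)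
end

section
/- Let (Σ, L, κ) be a state property system satisfying the axiom OrthoCom. If a is a classical property and x, y ∈ L satisfy x ≤ a and y ≤ aᗮ, then (x ⊔ y) ⊓ a = x. -/
namespace OrthoSPS

variable {σ : Type*} {L : Type*} [CompleteLattice L]

theorem mem_κ_inf (S : OrthoSPS σ L) (a b : L) (p : σ) :
    p ∈ S.κ (a ⊓ b) ↔ p ∈ S.κ a ∧ p ∈ S.κ b := by
  rw [← sInf_pair, S.κ_sInf]
  simp

theorem le_perp_comm (S : OrthoSPS σ L) {a b : L} (h : a ≤ S.perp b) : b ≤ S.perp a := by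
  simpa only [S.perp_perp] using S.perp_anti _ _ h

theorem perp_inf_perp_le (S : OrthoSPS σ L) (a b : L) :
    S.perp a ⊓ S.perp b ≤ S.perp (a ⊔ b) :=
  S.le_perp_comm (sup_le (S.le_perp_comm inf_le_left) (S.le_perp_comm inf_le_right))

end OrthoSPS

/-- if `a` is classical and `x ≤ a`, `y ≤ perp a`, then
`(x ⊔ y) ⊓ a = x`. -/
theorem sup_inf_classical {σ L : Type*} [CompleteLattice L] (S : OrthoSPS σ L)
    (a x y : L) (ha : S.IsClassical a) (hx : x ≤ a) (hy : y ≤ S.perp a) :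
    (x ⊔ y) ⊓ a = x := by
  refine le_antisymm ((S.le_iff _ _).2 fun q hq => ?_) (le_inf le_sup_left hx)
  obtain ⟨hq_sup, hqa⟩ := (S.mem_κ_inf _ _ _).1 hq
  rw [← S.perp_perp x]
  refine S.orthoCom _ _ fun p hp => ?_
  rcases ha p with hpa | hpa
  · have hpy : p ∈ S.κ (S.perp y) := (S.le_iff _ _).1 (S.le_perp_comm hy) hpa
    exact ⟨x ⊔ y, hq_sup,
      (S.le_iff _ _).1 (S.perp_inf_perp_le x y) ((S.mem_κ_inf _ _ _).2 ⟨hp, hpy⟩)⟩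
  · exact ⟨a, hqa, hpa⟩
end
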